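/- Let 0 < e ≤ 1/2 and let g be a graphon with e(g) = e, t(g) = 0 and I(g) = I₀(2e)/2. Then g is equivalent to the graphon g₀ defined by g₀(x,y) = 2e if x < 1/2 < y or y < 1/2 < x, and g₀(x,y) = 0 otherwise. -/

import Mathlib

open MeasureTheory Real Set Filter

noncomputable section

/-- `I₀(u) = (1/2)[u ln u + (1-u) ln(1-u)]`, with the convention `log 0 = 0`
    giving `I₀(0) = I₀(1) = 0`. -/
def I0 (u : ℝ) : ℝ := (u * Real.log u + (1 - u) * Real.log (1 - u)) / 2

/-- `I₀'(u) = (1/2)[ln u − ln(1−u)]`. -/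
def I0d (u : ℝ) : ℝ := (Real.log u - Real.log (1 - u)) / 2

/-- `I₀''(u) = (1/2)[1/u + 1/(1−u)]`. -/
def I0dd (u : ℝ) : ℝ := (1 / u + 1 / (1 - u)) / 2

/-- A graphon: a measurable, symmetric function `[0,1]² → [0,1]`
    (here defined on all of `ℝ²`, with values used only on `[0,1]²`). -/
def IsGraphon (g : ℝ → ℝ → ℝ) : Prop :=
  Measurable (Function.uncurry g) ∧ (∀ x y, g x y = g y x) ∧ ∀ x y, g x y ∈ Icc (0 : ℝ) 1

/-- The edge density `e(g) = ∫₀¹∫₀¹ g(x,y) dx dy`. -/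
def edgeDensity (g : ℝ → ℝ → ℝ) : ℝ :=
  ∫ x in Icc (0 : ℝ) 1, ∫ y in Icc (0 : ℝ) 1, g x y

/-- The triangle density `t(g) = ∫₀¹∫₀¹∫₀¹ g(x,y) g(y,z) g(z,x) dx dy dz`. -/
def triangleDensity (g : ℝ → ℝ → ℝ) : ℝ :=
  ∫ x in Icc (0 : ℝ) 1, ∫ y in Icc (0 : ℝ) 1, ∫ z in Icc (0 : ℝ) 1, g x y * g y z * g z x

/-- The rate function `I(g) = ∫₀¹∫₀¹ I₀(g(x,y)) dx dy`. -/
def rate (g : ℝ → ℝ → ℝ) : ℝ :=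
  ∫ x in Icc (0 : ℝ) 1, ∫ y in Icc (0 : ℝ) 1, I0 (g x y)

/-- Lebesgue measure restricted to `[0,1]`. -/
def unitMeasure : Measure ℝ := volume.restrict (Icc (0 : ℝ) 1)

/-- Two graphons are equivalent if they agree a.e. after composing with
    measure-preserving maps of `[0,1]`. -/
def GraphonEquiv (f g : ℝ → ℝ → ℝ) : Prop :=
  ∃ σ σ' : ℝ → ℝ, MeasurePreserving σ unitMeasure unitMeasure ∧
    MeasurePreserving σ' unitMeasure unitMeasure ∧
    ∀ᵐ p ∂(unitMeasure.prod unitMeasure), f (σ p.1) (σ p.2) = g (σ' p.1) (σ' p.2)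

end

/-- The bipartite-type graphon taking value `a` on
    `{x < 1/2 < y} ∪ {y < 1/2 < x}` and `0` elsewhere. -/
noncomputable def bip (a : ℝ) : ℝ → ℝ → ℝ := fun x y =>
  if (x < 1 / 2 ∧ 1 / 2 < y) ∨ (y < 1 / 2 ∧ 1 / 2 < x) then a else 0

section TriangleFree

variable {α : Type*} [MeasurableSpace α] {μ : Measure α} [IsProbabilityMeasure μ] {S : Set (α × α)}

/-- The vertex degree of a measurable graph with edge set `S`. -/
noncomputable def sectionDegree (μ : Measure α) (S : Set (α × α)) (x : α) : ℝ :=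
  μ.real (Prod.mk x ⁻¹' S)

theorem measurable_sectionDegree (hS : MeasurableSet S) : Measurable (sectionDegree μ S) :=
  (measurable_measure_prodMk_left hS).ennreal_toReal

theorem sectionDegree_mem_Icc (x : α) : sectionDegree μ S x ∈ Icc (0 : ℝ) 1 :=
  ⟨measureReal_nonneg, measureReal_le_one⟩

theorem integrable_of_mem_Icc {β : Type*} [MeasurableSpace β] {ν : Measure β} [IsFiniteMeasure ν]
    {f : β → ℝ} {a b : ℝ} (hf : Measurable f) (h : ∀ x, f x ∈ Icc a b) : Integrable f ν :=
  Integrable.of_mem_Icc a b hf.aemeasurable (ae_of_all _ h)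

theorem integral_sectionDegree (hS : MeasurableSet S) :
    ∫ x, sectionDegree μ S x ∂μ = ∫ p, S.indicator 1 p ∂(μ.prod μ) := by
  rw [integral_prod (S.indicator (1 : α × α → ℝ)) ((integrable_const (1 : ℝ)).indicator hS)]
  refine integral_congr_ae (ae_of_all _ fun x => ?_)
  change _ = ∫ y, (Prod.mk x ⁻¹' S).indicator 1 y ∂μ
  rw [integral_indicator_one (measurable_prodMk_left hS)]
  rfl

/-- An edge of a triangle-free graph has disjoint end neighbourhoods, so its end degrees sum to
at most one; averaging over the edges bounds the second moment of the degree. -/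
theorem integral_sectionDegree_sq_le (hS : MeasurableSet S)
    (hsymm : ∀ x y, (x, y) ∈ S → (y, x) ∈ S)
    (htri : ∀ᵐ x ∂μ, ∀ᵐ y ∂μ, (x, y) ∈ S → μ (Prod.mk x ⁻¹' S ∩ Prod.mk y ⁻¹' S) = 0) :
    2 * ∫ x, sectionDegree μ S x ^ 2 ∂μ ≤ ∫ x, sectionDegree μ S x ∂μ := by
  set d := sectionDegree μ S with hd
  have hdm : Measurable d := measurable_sectionDegree hS
  have hd01 : ∀ x, d x ∈ Icc (0 : ℝ) 1 := sectionDegree_mem_Icc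
  have hWm : Measurable (S.indicator (1 : α × α → ℝ)) := measurable_one.indicator hS
  have hW01 : ∀ p, S.indicator (1 : α × α → ℝ) p ∈ Icc (0 : ℝ) 1 := fun p => by
    by_cases hp : p ∈ S <;> simp [hp]
  have hfstInt : Integrable (fun p : α × α => S.indicator 1 p * d p.1) (μ.prod μ) :=
    integrable_of_mem_Icc (a := 0) (b := 1) (hWm.mul (hdm.comp measurable_fst)) fun p =>
      ⟨mul_nonneg (hW01 p).1 (hd01 _).1, mul_le_one₀ (hW01 p).2 (hd01 _).1 (hd01 _).2⟩
  have hswap : ∀ p : α × α, S.indicator (1 : α × α → ℝ) p.swap = S.indicator 1 p := fun p => by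
    have : p.swap ∈ S ↔ p ∈ S := ⟨hsymm _ _, hsymm _ _⟩
    by_cases hp : p ∈ S <;> simp [hp, this]
  have hfst : ∫ p, S.indicator 1 p * d p.1 ∂(μ.prod μ) = ∫ x, d x ^ 2 ∂μ := by
    rw [integral_prod _ hfstInt]
    refine integral_congr_ae (ae_of_all _ fun x => ?_)
    change ∫ y, (Prod.mk x ⁻¹' S).indicator 1 y * d x ∂μ = _
    rw [integral_mul_const, integral_indicator_one (measurable_prodMk_left hS)]
    exact (sq _).symm
  have hsnd : ∫ p, S.indicator 1 p * d p.2 ∂(μ.prod μ) = ∫ x, d x ^ 2 ∂μ := by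
    rw [← hfst, ← integral_prod_swap]
    simp [hswap]
  have hsndInt : Integrable (fun p : α × α => S.indicator 1 p * d p.2) (μ.prod μ) := by
    simpa [Function.comp_def, hswap] using hfstInt.swap
  have hsum : ∀ᵐ p ∂(μ.prod μ), S.indicator 1 p * d p.1 + S.indicator 1 p * d p.2
      ≤ S.indicator (1 : α × α → ℝ) p := by
    rw [Measure.ae_prod_iff_ae_ae]
    · filter_upwards [htri] with x hx
      filter_upwards [hx] with y hy
      by_cases hxy : (x, y) ∈ S
      · have hu := measureReal_union_add_inter (μ := μ) (s := Prod.mk x ⁻¹' S)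
          (measurable_prodMk_left (x := y) hS)
        rw [measureReal_def (s := _ ∩ _), hy hxy] at hu
        have : μ.real (Prod.mk x ⁻¹' S ∪ Prod.mk y ⁻¹' S) ≤ 1 := measureReal_le_one
        simp only [hxy, indicator_of_mem, Pi.one_apply, one_mul, hd, sectionDegree]
        simp at hu
        linarith
      · simp [hxy]
    · exact measurableSet_le ((hWm.mul (hdm.comp measurable_fst)).add
        (hWm.mul (hdm.comp measurable_snd))) hWm
  have := integral_mono_ae (hfstInt.add hsndInt) (integrable_of_mem_Icc hWm hW01) hsum
  rw [← integral_sectionDegree hS] at this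
  simp only [Pi.add_apply] at this
  rw [integral_add hfstInt hsndInt, hfst, hsnd] at this
  linarith

theorem integral_sectionDegree_sub_half_sq (hS : MeasurableSet S) :
    ∫ x, (sectionDegree μ S x - 1 / 2) ^ 2 ∂μ
      = ∫ x, sectionDegree μ S x ^ 2 ∂μ - ∫ x, sectionDegree μ S x ∂μ + 1 / 4 := by
  have hdm : Measurable (sectionDegree μ S) := measurable_sectionDegree hS
  have h1 : Integrable (sectionDegree μ S) μ := integrable_of_mem_Icc hdm sectionDegree_mem_Icc
  have h2 : Integrable (fun x => sectionDegree μ S x ^ 2) μ :=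
    integrable_of_mem_Icc (a := 0) (b := 1) (hdm.pow_const 2) fun x =>
      ⟨sq_nonneg _, pow_le_one₀ (sectionDegree_mem_Icc x).1 (sectionDegree_mem_Icc x).2⟩
  rw [← integral_sub h2 h1]
  have h3 : Integrable (fun _ : α => (1 / 4 : ℝ)) μ := integrable_const _
  have h4 := integral_add (h2.sub h1) h3
  simp only [Pi.sub_apply, integral_const, probReal_univ, one_smul] at h4
  rw [← h4]
  exact integral_congr_ae (ae_of_all _ fun x => by ring)

/-- Mantel's theorem for measurable graphs. -/
theorem integral_sectionDegree_le_half (hS : MeasurableSet S)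
    (hsymm : ∀ x y, (x, y) ∈ S → (y, x) ∈ S)
    (htri : ∀ᵐ x ∂μ, ∀ᵐ y ∂μ, (x, y) ∈ S → μ (Prod.mk x ⁻¹' S ∩ Prod.mk y ⁻¹' S) = 0) :
    ∫ x, sectionDegree μ S x ∂μ ≤ 1 / 2 := by
  have h1 := integral_sectionDegree_sq_le hS hsymm htri
  have h2 := integral_sectionDegree_sub_half_sq (μ := μ) hS
  have h3 : 0 ≤ ∫ x, (sectionDegree μ S x - 1 / 2) ^ 2 ∂μ :=
    integral_nonneg fun x => sq_nonneg _
  linarith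

theorem ae_sectionDegree_eq_half (hS : MeasurableSet S)
    (hsymm : ∀ x y, (x, y) ∈ S → (y, x) ∈ S)
    (htri : ∀ᵐ x ∂μ, ∀ᵐ y ∂μ, (x, y) ∈ S → μ (Prod.mk x ⁻¹' S ∩ Prod.mk y ⁻¹' S) = 0)
    (hhalf : ∫ x, sectionDegree μ S x ∂μ = 1 / 2) :
    ∀ᵐ x ∂μ, μ (Prod.mk x ⁻¹' S) = 2⁻¹ := by
  have h1 := integral_sectionDegree_sq_le hS hsymm htri
  have h2 := integral_sectionDegree_sub_half_sq (μ := μ) hS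
  have h3 : 0 ≤ ∫ x, (sectionDegree μ S x - 1 / 2) ^ 2 ∂μ :=
    integral_nonneg fun x => sq_nonneg _
  have h4 : ∫ x, (sectionDegree μ S x - 1 / 2) ^ 2 ∂μ = 0 := by linarith
  rw [integral_eq_zero_iff_of_nonneg (fun x => sq_nonneg _)] at h4
  · filter_upwards [h4] with x hx
    have hx' : sectionDegree μ S x = 1 / 2 := by
      have := pow_eq_zero_iff (two_ne_zero) |>.1 hx
      linarith
    rw [← ENNReal.toReal_eq_toReal_iff' (measure_ne_top _ _) (by simp)]
    simpa [sectionDegree, measureReal_def] using hx'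
  · refine integrable_of_mem_Icc (a := 0) (b := 1)
      (((measurable_sectionDegree hS).sub_const _).pow_const 2) fun x => ⟨sq_nonneg _, ?_⟩
    have := sectionDegree_mem_Icc (μ := μ) (S := S) x
    nlinarith [this.1, this.2]

/-- The equality case of Mantel's theorem: a triangle-free measurable graph of edge density `1/2`
is a balanced complete bipartite graph. -/
theorem exists_bipartition (hS : MeasurableSet S)
    (hsymm : ∀ x y, (x, y) ∈ S → (y, x) ∈ S)
    (htri : ∀ᵐ x ∂μ, ∀ᵐ y ∂μ, (x, y) ∈ S → μ (Prod.mk x ⁻¹' S ∩ Prod.mk y ⁻¹' S) = 0)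
    (hhalf : ∫ x, sectionDegree μ S x ∂μ = 1 / 2) :
    ∃ A : Set α, MeasurableSet A ∧ μ A = 2⁻¹ ∧
      ∀ᵐ x ∂μ, ∀ᵐ y ∂μ, ((x, y) ∈ S ↔ (x ∈ A ↔ y ∉ A)) := by
  have hdeg := ae_sectionDegree_eq_half hS hsymm htri hhalf
  obtain ⟨w, hwtri, hwdeg⟩ := (htri.and hdeg).exists
  have hm : ∀ x, MeasurableSet (Prod.mk x ⁻¹' S) := fun x => measurable_prodMk_left hS
  set A : Set α := Prod.mk w ⁻¹' S with hA
  have hAc : μ Aᶜ = 2⁻¹ := by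
    rw [prob_compl_eq_one_sub (hm w), hwdeg, ENNReal.one_sub_inv_two]
  have hin : ∀ᵐ x ∂μ, x ∈ A → ∀ᵐ y ∂μ, ((x, y) ∈ S ↔ y ∉ A) := by
    filter_upwards [hwtri, hdeg] with x hx hxd hxA
    have hsub : Prod.mk x ⁻¹' S ≤ᵐ[μ] Aᶜ := by
      have := measure_eq_zero_iff_ae_notMem.1 (hx hxA)
      filter_upwards [this] with y hy hyx hyA using hy ⟨hyA, hyx⟩
    have := ae_eq_of_ae_subset_of_measure_ge hsub (hAc.trans hxd.symm).le
      (hm x).nullMeasurableSet (measure_ne_top _ _)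
    filter_upwards [this.mem_iff] with y hy using hy
  have hout : ∀ᵐ x ∂μ, x ∉ A → ∀ᵐ y ∂μ, ((x, y) ∈ S ↔ y ∈ A) := by
    have hcomm : ∀ᵐ x ∂μ, ∀ᵐ y ∂μ, (y ∈ A ∧ x ∉ A → (y, x) ∈ S) := by
      rw [Measure.ae_ae_comm]
      · filter_upwards [hin] with y hy
        by_cases hyA : y ∈ A
        · filter_upwards [hy hyA] with x hx h using hx.2 h.2
        · simp [hyA]
      · have h1 : MeasurableSet {p : α × α | p.2 ∈ A ∧ p.1 ∉ A} :=
          (measurable_snd (hm w)).inter (measurable_fst (hm w).compl)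
        exact h1.imp (measurable_swap hS)
    filter_upwards [hcomm, hdeg] with x hx hxd hxA
    have hsub : A ≤ᵐ[μ] Prod.mk x ⁻¹' S := by
      filter_upwards [hx] with y hy hyA using hsymm _ _ (hy ⟨hyA, hxA⟩)
    have := ae_eq_of_ae_subset_of_measure_ge hsub (hxd.trans hwdeg.symm).le
      (hm w).nullMeasurableSet (measure_ne_top _ _)
    filter_upwards [this.mem_iff] with y hy using hy.symm
  refine ⟨A, hm w, hwdeg, ?_⟩
  filter_upwards [hin, hout] with x h1 h2
  by_cases hx : x ∈ A
  · simpa [hx] using h1 hx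
  · simpa [hx] using h2 hx

end TriangleFree

section Transport

/-- The probability integral transform, for a finite measure dominated by Lebesgue measure. -/
theorem map_real_Iic_eq_restrict_volume {ν : Measure ℝ} [IsFiniteMeasure ν] (hν : ν ≤ volume) :
    ν.map (fun x => ν.real (Iic x)) = volume.restrict (Icc 0 (ν.real univ)) := by
  set F : ℝ → ℝ := fun x => ν.real (Iic x) with hF
  set m := ν.real univ with hm
  have hmono : Monotone F := fun x y hxy => measureReal_mono (Iic_subset_Iic.2 hxy)
  have hF0 : ∀ x, 0 ≤ F x := fun x => measureReal_nonneg
  have hFm : ∀ x, F x ≤ m := fun x => measureReal_mono (subset_univ _)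
  have hm0 : 0 ≤ m := measureReal_nonneg
  have hlip : ∀ x y, x ≤ y → F y - F x ≤ y - x := fun x y hxy => by
    have h1 : F y = F x + ν.real (Ioc x y) := by
      rw [hF, ← measureReal_union (Iic_disjoint_Ioc le_rfl) measurableSet_Ioc,
        Iic_union_Ioc_eq_Iic hxy]
    have h2 : ν.real (Ioc x y) ≤ y - x := by
      refine ENNReal.toReal_le_of_le_ofReal (sub_nonneg.2 hxy) ?_
      rw [← Real.volume_Ioc]
      exact hν _
    linarith
  have hcont : Continuous F := by
    refine (LipschitzWith.of_dist_le_mul (K := 1) fun x y => ?_).continuous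
    rw [NNReal.coe_one, one_mul, Real.dist_eq, Real.dist_eq]
    rcases le_total x y with h | h
    · rw [abs_sub_comm, abs_sub_comm x, abs_of_nonneg (sub_nonneg.2 (hmono h)),
        abs_of_nonneg (sub_nonneg.2 h)]
      exact hlip x y h
    · rw [abs_of_nonneg (sub_nonneg.2 (hmono h)), abs_of_nonneg (sub_nonneg.2 h)]
      exact hlip y x h
  have htop : Tendsto F atTop (nhds m) :=
    (ENNReal.tendsto_toReal (measure_ne_top _ _)).comp (tendsto_measure_Iic_atTop ν)
  have hbot : Tendsto F atBot (nhds 0) := by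
    have h1 : Tendsto (fun x => ν (Iic x)) atBot (nhds 0) := by
      have := tendsto_measure_iInter_atBot (μ := ν) (s := fun x : ℝ => Iic x)
        (fun x => measurableSet_Iic.nullMeasurableSet) (fun x y h => Iic_subset_Iic.2 h)
        ⟨0, measure_ne_top _ _⟩
      have he : ⋂ x : ℝ, Iic x = ∅ := iInter_Iic_eq_empty_iff.2 (by simp)
      rwa [he, measure_empty] at this
    exact (ENNReal.tendsto_toReal ENNReal.zero_ne_top).comp h1
  have hsurj : ∀ t ∈ Ioo 0 m, ∃ x, F x = t := fun t ht =>
    mem_range_of_exists_le_of_exists_ge hcont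
      ((hbot.eventually (gt_mem_nhds ht.1)).exists.imp fun _ h => h.le)
      ((htop.eventually (lt_mem_nhds ht.2)).exists.imp fun _ h => h.le)
  have hlow : ∀ t ∈ Ioo 0 m, t ≤ ν.real {x | F x ≤ t} := fun t ht => by
    obtain ⟨x, hx⟩ := hsurj t ht
    calc t = F x := hx.symm
      _ ≤ _ := measureReal_mono fun y (hy : y ≤ x) => (hmono hy).trans hx.le
  have hupp : ∀ t ∈ Ico 0 m, ν.real {x | F x ≤ t} ≤ t := fun t ht => by
    refine le_of_forall_gt_imp_ge_of_dense fun s hs => ?_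
    rcases lt_or_ge s m with hsm | hsm
    · obtain ⟨x, hx⟩ := hsurj s ⟨ht.1.trans_lt hs, hsm⟩
      calc ν.real {x | F x ≤ t} ≤ F x := measureReal_mono fun y (hy : F y ≤ t) => by
            by_contra hyx
            have := hmono (not_le.1 hyx).le
            linarith
        _ = s := hx
    · exact (measureReal_mono (subset_univ _)).trans hsm
  refine Measure.ext_of_Iic _ _ fun t => ?_
  rw [Measure.map_apply hmono.measurable measurableSet_Iic,
    Measure.restrict_apply measurableSet_Iic]
  change ν {x | F x ≤ t} = _
  rcases lt_or_ge t 0 with ht | ht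
  · have h1 : {x | F x ≤ t} = ∅ := eq_empty_of_forall_notMem fun x hx =>
      (ht.trans_le (hF0 x)).not_ge hx
    have h2 : Iic t ∩ Icc 0 m = ∅ := eq_empty_of_forall_notMem fun x hx =>
      (ht.trans_le hx.2.1).not_ge hx.1
    simp [h1, h2]
  rcases le_or_gt m t with htm | htm
  · have h1 : {x | F x ≤ t} = univ := eq_univ_of_forall fun x => (hFm x).trans htm
    have h2 : Iic t ∩ Icc 0 m = Icc 0 m := inter_eq_right.2 fun x hx => hx.2.trans htm
    rw [h1, h2, Real.volume_Icc, sub_zero, hm, ofReal_measureReal]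
  · have h2 : Iic t ∩ Icc 0 m = Icc 0 t := by
      ext x
      simp only [mem_inter_iff, mem_Iic, mem_Icc]
      exact ⟨fun h => ⟨h.2.1, h.1⟩, fun h => ⟨h.2, h.1, h.2.trans htm.le⟩⟩
    rw [h2, Real.volume_Icc, sub_zero, ← ofReal_measureReal]
    congr 1
    rcases ht.eq_or_lt with rfl | ht0
    · exact le_antisymm (hupp 0 ⟨le_rfl, htm⟩) measureReal_nonneg
    · exact le_antisymm (hupp t ⟨ht, htm⟩) (hlow t ⟨ht0, htm⟩)

instance isProbabilityMeasure_unitMeasure : IsProbabilityMeasure unitMeasure :=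
  ⟨by simp [unitMeasure]⟩

theorem unitMeasure_le_volume : unitMeasure ≤ volume := Measure.restrict_le_self

theorem ae_mem_Ioo_of_map_restrict_eq {A : Set ℝ} {f : ℝ → ℝ} (hA : MeasurableSet A)
    (hf : Measurable f) {a b : ℝ}
    (h : (unitMeasure.restrict A).map f = volume.restrict (Icc a b)) :
    ∀ᵐ x ∂unitMeasure, x ∈ A → f x ∈ Ioo a b := by
  rw [← ae_restrict_iff' hA]
  refine ae_of_ae_map hf.aemeasurable ?_
  rw [h, ← restrict_Ioo_eq_restrict_Icc]
  exact ae_restrict_mem measurableSet_Ioo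

/-- A set of measure `1/2` and its complement can be moved, preserving measure, onto the two halves
of the unit interval. -/
theorem exists_measurePreserving_halves {A : Set ℝ} (hA : MeasurableSet A)
    (hhalf : unitMeasure A = 2⁻¹) :
    ∃ τ : ℝ → ℝ, MeasurePreserving τ unitMeasure unitMeasure ∧
      (∀ᵐ x ∂unitMeasure, x ∈ A → τ x < 1 / 2) ∧ ∀ᵐ x ∂unitMeasure, x ∉ A → 1 / 2 < τ x := by
  classical
  have hAc : unitMeasure Aᶜ = 2⁻¹ := by
    rw [prob_compl_eq_one_sub hA, hhalf, ENNReal.one_sub_inv_two]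
  have hle : ∀ B, unitMeasure.restrict B ≤ volume := fun B =>
    Measure.restrict_le_self.trans unitMeasure_le_volume
  set F : Set ℝ → ℝ → ℝ := fun B x => (unitMeasure.restrict B).real (Iic x) with hF
  have hFm : ∀ B, Measurable (F B) := fun B => Monotone.measurable fun x y hxy =>
    measureReal_mono (Iic_subset_Iic.2 hxy)
  have hmap : ∀ B, unitMeasure B = 2⁻¹ →
      (unitMeasure.restrict B).map (F B) = volume.restrict (Icc 0 (1 / 2)) := fun B hB => by
    rw [map_real_Iic_eq_restrict_volume (hle B)]
    simp [measureReal_def, hB]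
  have hmap' : (unitMeasure.restrict Aᶜ).map (fun x => F Aᶜ x + 1 / 2)
      = volume.restrict (Icc (1 / 2) 1) := by
    have h1 := Measure.map_map (μ := unitMeasure.restrict Aᶜ)
      (measurable_add_const (1 / 2 : ℝ)) (hFm Aᶜ)
    have h2 := ((measurePreserving_add_right (volume : Measure ℝ) (1 / 2)).restrict_preimage
      (measurableSet_Icc (a := 1 / 2) (b := (1 : ℝ)))).map_eq
    rw [preimage_add_const_Icc] at h2
    norm_num at h1 h2 ⊢
    rw [← h2, ← hmap _ hAc, h1]
    rfl
  set τ : ℝ → ℝ := A.piecewise (F A) (fun x => F Aᶜ x + 1 / 2) with hτ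
  have hτm : Measurable τ := (hFm A).piecewise hA ((hFm Aᶜ).add_const _)
  have hτA : (unitMeasure.restrict A).map τ = volume.restrict (Icc 0 (1 / 2)) := by
    rw [← hmap A hhalf]
    exact Measure.map_congr (piecewise_ae_eq_restrict hA)
  have hτAc : (unitMeasure.restrict Aᶜ).map τ = volume.restrict (Icc (1 / 2) 1) := by
    rw [← hmap']
    exact Measure.map_congr (piecewise_ae_eq_restrict_compl hA)
  refine ⟨τ, ⟨hτm, ?_⟩, ?_, ?_⟩
  · rw [← Measure.restrict_add_restrict_compl (μ := unitMeasure) hA, Measure.map_add _ _ hτm,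
      hτA, hτAc, Measure.restrict_add_restrict_compl hA, ← restrict_Ioc_eq_restrict_Icc,
      ← restrict_Ioc_eq_restrict_Icc, unitMeasure, ← restrict_Ioc_eq_restrict_Icc,
      ← Measure.restrict_union (Ioc_disjoint_Ioc_of_le le_rfl) measurableSet_Ioc,
      Ioc_union_Ioc_eq_Ioc (by norm_num) (by norm_num)]
  · filter_upwards [ae_mem_Ioo_of_map_restrict_eq hA hτm hτA] with x hx hxA using (hx hxA).2
  · filter_upwards [ae_mem_Ioo_of_map_restrict_eq hA.compl hτm hτAc] with x hx hxA using (hx hxA).1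

end Transport

section RateFunction

theorem I0_nonpos {u : ℝ} (hu : u ∈ Icc (0 : ℝ) 1) : I0 u ≤ 0 := by
  have h1 := mul_nonpos_of_nonneg_of_nonpos hu.1 (Real.log_nonpos hu.1 hu.2)
  have h2 := mul_nonpos_of_nonneg_of_nonpos (sub_nonneg.2 hu.2)
    (Real.log_nonpos (sub_nonneg.2 hu.2) (by linarith [hu.1]))
  unfold I0
  linarith

theorem I0_neg {u : ℝ} (hu : u ∈ Ioo (0 : ℝ) 1) : I0 u < 0 := by
  have h1 := mul_neg_of_pos_of_neg hu.1 (Real.log_neg hu.1 hu.2)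
  have h2 := mul_neg_of_pos_of_neg (sub_pos.2 hu.2)
    (Real.log_neg (sub_pos.2 hu.2) (by linarith [hu.1]))
  unfold I0
  linarith

theorem continuous_I0 : Continuous I0 :=
  (Real.continuous_mul_log.add
    (Real.continuous_mul_log.comp (continuous_const.sub continuous_id))).div_const 2

theorem mul_log_sub_le {u a : ℝ} (hu : 0 ≤ u) (ha : 0 < a) : u - a ≤ u * log u - u * log a := by
  rcases hu.eq_or_lt with rfl | hu
  · simp [ha.le]
  · have h := mul_le_mul_of_nonneg_left (Real.log_le_sub_one_of_pos (div_pos ha hu)) hu.le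
    rw [Real.log_div ha.ne' hu.ne', mul_sub, mul_sub, mul_div_cancel₀ _ hu.ne'] at h
    linarith

theorem mul_log_sub_lt {u a : ℝ} (hu : 0 < u) (ha : 0 < a) (hua : u ≠ a) :
    u - a < u * log u - u * log a := by
  have hne : a / u ≠ 1 := fun h => hua ((div_eq_one_iff_eq hu.ne').1 h).symm
  have h := mul_lt_mul_of_pos_left (Real.log_lt_sub_one_of_pos (div_pos ha hu) hne) hu
  rw [Real.log_div ha.ne' hu.ne', mul_sub, mul_sub, mul_div_cancel₀ _ hu.ne'] at h
  linarith

/-- `I0` lies above its tangent line at `a`. -/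
theorem tangent_le_I0 {u a : ℝ} (ha : a ∈ Ioo (0 : ℝ) 1) (hu : u ∈ Icc (0 : ℝ) 1) :
    I0d a * u + log (1 - a) / 2 ≤ I0 u := by
  have h1 := mul_log_sub_le hu.1 ha.1
  have h2 := mul_log_sub_le (sub_nonneg.2 hu.2) (sub_pos.2 ha.2)
  unfold I0 I0d
  linarith

theorem tangent_lt_I0 {u a : ℝ} (ha : a ∈ Ioo (0 : ℝ) 1) (hu : u ∈ Ioc (0 : ℝ) 1) (hua : u ≠ a) :
    I0d a * u + log (1 - a) / 2 < I0 u := by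
  have h1 := mul_log_sub_lt hu.1 ha.1 hua
  have h2 := mul_log_sub_le (sub_nonneg.2 hu.2) (sub_pos.2 ha.2)
  unfold I0 I0d
  linarith

theorem I0_eq_tangent {a : ℝ} : I0 a = I0d a * a + log (1 - a) / 2 := by
  unfold I0 I0d
  ring

end RateFunction

section Graphon

variable {g : ℝ → ℝ → ℝ}

/-- The set of edges of positive weight. -/
def graphonSupport (g : ℝ → ℝ → ℝ) : Set (ℝ × ℝ) := {p | 0 < g p.1 p.2}

theorem measurableSet_graphonSupport (hg : IsGraphon g) : MeasurableSet (graphonSupport g) :=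
  measurableSet_lt measurable_const hg.1

theorem graphonSupport_symm (hg : IsGraphon g) (x y : ℝ) (h : (x, y) ∈ graphonSupport g) :
    (y, x) ∈ graphonSupport g := by
  change 0 < g y x
  rw [hg.2.1 y x]
  exact h

theorem edgeDensity_eq_integral_prod (hg : IsGraphon g) :
    edgeDensity g = ∫ p, g p.1 p.2 ∂(unitMeasure.prod unitMeasure) :=
  (integral_prod (μ := unitMeasure) (ν := unitMeasure) (fun p : ℝ × ℝ => g p.1 p.2)
    (integrable_of_mem_Icc hg.1 fun p => hg.2.2 p.1 p.2)).symm

theorem integrable_I0_graphon (hg : IsGraphon g) :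
    Integrable (fun p : ℝ × ℝ => I0 (g p.1 p.2)) (unitMeasure.prod unitMeasure) := by
  obtain ⟨C, hC⟩ := (isCompact_Icc (a := (0 : ℝ)) (b := 1)).exists_bound_of_continuousOn
    continuous_I0.continuousOn
  exact Integrable.of_bound (continuous_I0.measurable.comp hg.1).aestronglyMeasurable C
    (ae_of_all _ fun p => hC _ (hg.2.2 p.1 p.2))

theorem rate_eq_integral_prod (hg : IsGraphon g) :
    rate g = ∫ p, I0 (g p.1 p.2) ∂(unitMeasure.prod unitMeasure) :=
  (integral_prod (μ := unitMeasure) (ν := unitMeasure) (fun p : ℝ × ℝ => I0 (g p.1 p.2))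
    (integrable_I0_graphon hg)).symm

theorem ae_disjoint_neighbourhoods (hg : IsGraphon g) (hgt : triangleDensity g = 0) :
    ∀ᵐ x ∂unitMeasure, ∀ᵐ y ∂unitMeasure, (x, y) ∈ graphonSupport g →
      unitMeasure (Prod.mk x ⁻¹' graphonSupport g ∩ Prod.mk y ⁻¹' graphonSupport g) = 0 := by
  obtain ⟨hm, hs, h01⟩ := hg
  have hf01 : ∀ x y z, g x y * g y z * g z x ∈ Icc (0 : ℝ) 1 := fun x y z =>
    unitInterval.mul_mem (unitInterval.mul_mem (h01 x y) (h01 y z)) (h01 z x)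
  have hfm : Measurable fun p : (ℝ × ℝ) × ℝ => g p.1.1 p.1.2 * g p.1.2 p.2 * g p.2 p.1.1 :=
    ((hm.comp (measurable_fst)).mul
      (hm.comp ((measurable_snd.comp measurable_fst).prodMk measurable_snd))).mul
      (hm.comp (measurable_snd.prodMk (measurable_fst.comp measurable_fst)))
  have hfxm : ∀ x y, Measurable fun z => g x y * g y z * g z x := fun x y =>
    hfm.comp (measurable_prodMk_left (x := (x, y)))
  have hinner : ∀ x y, ∫ z, g x y * g y z * g z x ∂unitMeasure ∈ Icc (0 : ℝ) 1 := fun x y =>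
    ⟨integral_nonneg fun z => (hf01 x y z).1, by
      refine (integral_mono (integrable_of_mem_Icc (hfxm x y) (hf01 x y))
        (integrable_const 1) fun z => (hf01 x y z).2).trans ?_
      simp⟩
  have hinnerm : Measurable fun p : ℝ × ℝ => ∫ z, g p.1 p.2 * g p.2 z * g z p.1 ∂unitMeasure :=
    hfm.stronglyMeasurable.integral_prod_right'.measurable
  have houter : ∀ x, ∫ y, ∫ z, g x y * g y z * g z x ∂unitMeasure ∂unitMeasure ∈ Icc (0 : ℝ) 1 :=
    fun x => ⟨integral_nonneg fun y => (hinner x y).1, by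
      refine (integral_mono (integrable_of_mem_Icc (hinnerm.comp measurable_prodMk_left) (hinner x))
        (integrable_const 1) fun y => (hinner x y).2).trans ?_
      simp⟩
  have houterm : Measurable fun x => ∫ y, ∫ z, g x y * g y z * g z x ∂unitMeasure ∂unitMeasure :=
    hinnerm.stronglyMeasurable.integral_prod_right'.measurable
  have h0 := (integral_eq_zero_iff_of_nonneg (fun x => (houter x).1)
    (integrable_of_mem_Icc houterm houter)).1 hgt
  filter_upwards [h0] with x hx
  have h1 := (integral_eq_zero_iff_of_nonneg (fun y => (hinner x y).1)
    (integrable_of_mem_Icc (hinnerm.comp measurable_prodMk_left) (hinner x))).1 hx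
  filter_upwards [h1] with y hy hxy
  have h2 := (integral_eq_zero_iff_of_nonneg (fun z => (hf01 x y z).1)
    (integrable_of_mem_Icc (hfxm x y) (hf01 x y))).1 hy
  rw [measure_eq_zero_iff_ae_notMem]
  filter_upwards [h2] with z hz hmem
  have hxz : 0 < g x z := hmem.1
  have hyz : 0 < g y z := hmem.2
  rw [hs x z] at hxz
  exact (mul_pos (mul_pos hxy hyz) hxz).ne' hz

theorem ae_eq_zero_or_one_of_rate_eq_zero (hg : IsGraphon g) (hI : rate g = 0) :
    ∀ᵐ p ∂(unitMeasure.prod unitMeasure), g p.1 p.2 = 0 ∨ g p.1 p.2 = 1 := by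
  rw [rate_eq_integral_prod hg, ← neg_eq_zero, ← integral_neg] at hI
  replace hI := (integral_eq_zero_iff_of_nonneg
    (fun p : ℝ × ℝ => neg_nonneg.2 (I0_nonpos (hg.2.2 p.1 p.2)))
    (integrable_I0_graphon hg).neg).1 hI
  filter_upwards [hI] with p hp
  obtain ⟨h0, h1⟩ := hg.2.2 p.1 p.2
  by_contra! h
  exact (I0_neg ⟨h0.lt_of_ne' h.1, h1.lt_of_ne h.2⟩).ne (neg_eq_zero.1 hp)

/-- The tangent line bound on the support shows that a triangle-free graphon of minimal rate takes
only the values `0` and `a`. -/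
theorem ae_eq_zero_or_eq_of_rate_eq (hg : IsGraphon g) (hgt : triangleDensity g = 0) {a : ℝ}
    (ha : a ∈ Ioo (0 : ℝ) 1) (he : edgeDensity g = a / 2) (hI : rate g = I0 a / 2) :
    ∀ᵐ p ∂(unitMeasure.prod unitMeasure), g p.1 p.2 = 0 ∨ g p.1 p.2 = a := by
  set S := graphonSupport g
  have hS : MeasurableSet S := measurableSet_graphonSupport hg
  have hmantel := integral_sectionDegree_le_half hS (graphonSupport_symm hg)
    (ae_disjoint_neighbourhoods hg hgt)
  rw [integral_sectionDegree hS] at hmantel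
  have hlog : log (1 - a) / 2 ≤ 0 := by
    linarith [Real.log_neg (sub_pos.2 ha.2) (by linarith [ha.1])]
  have hgInt : Integrable (fun p : ℝ × ℝ => I0d a * g p.1 p.2) (unitMeasure.prod unitMeasure) :=
    (integrable_of_mem_Icc hg.1 fun p => hg.2.2 p.1 p.2).const_mul _
  have hsuppInt : Integrable (fun p : ℝ × ℝ => log (1 - a) / 2 * S.indicator 1 p)
      (unitMeasure.prod unitMeasure) :=
    ((integrable_const (1 : ℝ)).indicator hS).const_mul _
  set φ : ℝ × ℝ → ℝ := fun p =>
    I0 (g p.1 p.2) - (I0d a * g p.1 p.2 + log (1 - a) / 2 * S.indicator 1 p) with hφ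
  have hφi : Integrable φ (unitMeasure.prod unitMeasure) :=
    (integrable_I0_graphon hg).sub (hgInt.add hsuppInt)
  have hφ0 : ∀ p, 0 ≤ φ p := fun p => by
    by_cases hp : p ∈ S
    · have := tangent_le_I0 ha (hg.2.2 p.1 p.2)
      simp only [hφ, hp, indicator_of_mem, Pi.one_apply]
      linarith
    · have hp0 : g p.1 p.2 = 0 := le_antisymm (not_lt.1 hp) (hg.2.2 p.1 p.2).1
      simp [hφ, hp, hp0, I0]
  have hφint : ∫ p, φ p ∂(unitMeasure.prod unitMeasure) = 0 := by
    refine le_antisymm ?_ (integral_nonneg hφ0)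
    have hsub : ∫ p, φ p ∂(unitMeasure.prod unitMeasure) = _ :=
      integral_sub (integrable_I0_graphon hg) (hgInt.add hsuppInt)
    have hadd : _ = _ + _ := integral_add hgInt hsuppInt
    rw [integral_const_mul, integral_const_mul] at hadd
    rw [hsub, hadd, ← rate_eq_integral_prod hg, ← edgeDensity_eq_integral_prod hg, hI, he, I0_eq_tangent]
    nlinarith [mul_le_mul_of_nonpos_left hmantel hlog]
  rw [integral_eq_zero_iff_of_nonneg hφ0 hφi] at hφint
  filter_upwards [hφint] with p hp
  obtain ⟨h0, h1⟩ := hg.2.2 p.1 p.2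
  by_contra! h
  have hpS : p ∈ S := h0.lt_of_ne' h.1
  have := tangent_lt_I0 ha ⟨hpS, h1⟩ h.2
  simp only [hφ, hpS, indicator_of_mem, Pi.one_apply, Pi.zero_apply] at hp
  linarith

end Graphon

/-- for `0 < e ≤ 1/2`, any graphon `g` with `e(g) = e`, `t(g) = 0`
    and `I(g) = I₀(2e)/2` is equivalent to the bipartite graphon `g₀`. -/
theorem flat_scallop_minimizer_unique (e : ℝ) (he0 : 0 < e) (he : e ≤ 1 / 2)
    (g : ℝ → ℝ → ℝ) (hg : IsGraphon g) (hge : edgeDensity g = e)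
    (hgt : triangleDensity g = 0) (hgI : rate g = I0 (2 * e) / 2) :
    GraphonEquiv g (bip (2 * e)) := by
  classical
  set a := 2 * e with ha
  have hae : edgeDensity g = a / 2 := by rw [hge, ha]; ring
  have hvals : ∀ᵐ p ∂(unitMeasure.prod unitMeasure), g p.1 p.2 = 0 ∨ g p.1 p.2 = a := by
    rcases (show a ≤ 1 by linarith).eq_or_lt with h1 | h1
    · rw [h1]
      exact ae_eq_zero_or_one_of_rate_eq_zero hg (by rw [hgI, h1]; simp [I0])
    · exact ae_eq_zero_or_eq_of_rate_eq hg hgt ⟨by linarith, h1⟩ hae hgI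
  have hS := measurableSet_graphonSupport hg
  have hhalf : ∫ x, sectionDegree unitMeasure (graphonSupport g) x ∂unitMeasure = 1 / 2 := by
    have h1 : ∫ p, g p.1 p.2 ∂(unitMeasure.prod unitMeasure)
        = ∫ p, a * (graphonSupport g).indicator 1 p ∂(unitMeasure.prod unitMeasure) := by
      refine integral_congr_ae ?_
      filter_upwards [hvals] with p hp
      rcases hp with hp | hp
      · simp [graphonSupport, hp]
      · simp [graphonSupport, hp, show 0 < a by linarith]
    rw [← edgeDensity_eq_integral_prod hg, integral_const_mul, ← integral_sectionDegree hS, hae,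
      div_eq_mul_one_div] at h1
    exact (mul_left_cancel₀ (by linarith) h1).symm
  obtain ⟨A, hA, hA2, hbip⟩ := exists_bipartition hS (graphonSupport_symm hg)
    (ae_disjoint_neighbourhoods hg hgt) hhalf
  obtain ⟨τ, hτ, hlow, hupp⟩ := exists_measurePreserving_halves hA hA2
  refine ⟨id, τ, MeasurePreserving.id _, hτ, ?_⟩
  have hbip' : ∀ᵐ p ∂(unitMeasure.prod unitMeasure),
      (p ∈ graphonSupport g ↔ (p.1 ∈ A ↔ p.2 ∉ A)) := by
    rw [Measure.ae_prod_iff_ae_ae]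
    · exact hbip
    · exact hS.iff ((measurable_fst hA).iff (measurable_snd hA).compl)
  have hfst := (Measure.quasiMeasurePreserving_fst (μ := unitMeasure) (ν := unitMeasure)).ae
    (hlow.and hupp)
  have hsnd := (Measure.quasiMeasurePreserving_snd (μ := unitMeasure) (ν := unitMeasure)).ae
    (hlow.and hupp)
  filter_upwards [hvals, hbip', hfst, hsnd] with p hp hpA h1 h2
  have hpS : g p.1 p.2 = if p ∈ graphonSupport g then a else 0 := by
    rcases hp with hp | hp
    · simp [graphonSupport, hp]
    · simp [graphonSupport, hp, show 0 < a by linarith]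
  rw [id, id, hpS, bip]
  refine if_congr (hpA.trans ?_) rfl rfl
  clear hpA hpS hp
  grind
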